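/- Assume K¹,K² are continuous symmetric positive definite kernels with ∫_T [K^i(x,x)]² dν(x) ≤ κ_i⁴ for i=1,2 (the kernels need not be bounded). Let X = (x_1,…,x_m) be sampled independently from (T,ν). Then for every 0 < δ < 1, with probability at least 1−δ, both ‖R_{ij,X}‖_{HS(H_{K^j},H_{K^i})} ≤ 2κ_i κ_j/δ and ‖R_{ij,X} − R_{ij}‖_{HS(H_{K^j},H_{K^i})} ≤ 2κ_i κ_j/(√m · δ), for i,j ∈ {1,2}. In particular, taking K¹ = K² = K with ∫_T K(x,x)² dν(x) ≤ κ⁴: with probability at least 1−δ, ‖L_{K,X}‖_{HS(H_K)} ≤ 2κ²/δ and ‖L_{K,X} − L_K‖_{HS(H_K)} ≤ 2κ²/(√m · δ). -/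

import Mathlib

/- STATEMENT 3: general (not necessarily bounded) kernels with `∫ [K^i(x,x)]² dν ≤ κ_i⁴`.
With the RKHS/feature-map encoding (`H i`, `Φ i`, Hilbert bases `e i`),
`R i j = ∫ K^i_t ⊗ K^j_t dν(t)` and `RX i j X = (1/m) Σ_k K^i_{X k} ⊗ K^j_{X k}`
(note `RX i i X = L_{K^i,X}`, `R i i = L_{K^i}`, which covers the "in particular" case
`K¹ = K² = K`): for `X = (x_1,…,x_m)` i.i.d. from `ν` and every `0 < δ < 1`, with
probability at least `1−δ`, both `‖RX i j X‖_HS ≤ 2κ_i κ_j/δ` and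
`‖RX i j X − R i j‖_HS ≤ 2κ_i κ_j/(√m δ)`, for all `i, j`. -/

open MeasureTheory
open scoped RealInnerProductSpace

noncomputable section

/-- The mean square of an empirical mean is at most the mean square of a single sample. -/
lemma lintegral_sq_empiricalMean_le {T : Type*} [MeasurableSpace T] (ν : Measure T)
    [IsProbabilityMeasure ν] {f : T → ℝ} (hf : Measurable f) {m : ℕ} (hm : 0 < m) :
    ∫⁻ X : Fin m → T, ENNReal.ofReal (((m : ℝ)⁻¹ * ∑ s, f (X s)) ^ 2)
        ∂(Measure.pi fun _ : Fin m => ν) ≤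
      ∫⁻ t, ENNReal.ofReal (f t ^ 2) ∂ν := by
  have hm' : (0 : ℝ) < m := by exact_mod_cast hm
  have hpt (X : Fin m → T) : ENNReal.ofReal (((m : ℝ)⁻¹ * ∑ s, f (X s)) ^ 2) ≤
      ENNReal.ofReal (m : ℝ)⁻¹ * ∑ s, ENNReal.ofReal (f (X s) ^ 2) := by
    rw [← ENNReal.ofReal_sum_of_nonneg (fun s _ => sq_nonneg _),
      ← ENNReal.ofReal_mul (by positivity)]
    apply ENNReal.ofReal_le_ofReal
    have h := sq_sum_le_card_mul_sum_sq (s := Finset.univ) (f := fun s => f (X s))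
    rw [Finset.card_univ, Fintype.card_fin] at h
    calc ((m : ℝ)⁻¹ * ∑ s, f (X s)) ^ 2 = (m : ℝ)⁻¹ ^ 2 * (∑ s, f (X s)) ^ 2 := by ring
      _ ≤ (m : ℝ)⁻¹ ^ 2 * (m * ∑ s, f (X s) ^ 2) := by gcongr
      _ = _ := by field_simp
  have hmeas : Measurable fun t => ENNReal.ofReal (f t ^ 2) := by fun_prop
  have heval (s : Fin m) : ∫⁻ X : Fin m → T, ENNReal.ofReal (f (X s) ^ 2)
      ∂(Measure.pi fun _ : Fin m => ν) = ∫⁻ t, ENNReal.ofReal (f t ^ 2) ∂ν :=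
    (measurePreserving_eval (fun _ : Fin m => ν) s).lintegral_comp hmeas
  refine (lintegral_mono hpt).trans ?_
  rw [lintegral_const_mul _ (by fun_prop), lintegral_finsetSum _ (fun s _ => by fun_prop)]
  simp_rw [heval]
  rw [Finset.sum_const, Finset.card_univ, Fintype.card_fin, nsmul_eq_mul, ← mul_assoc,
    ← ENNReal.ofReal_natCast, ← ENNReal.ofReal_mul (by positivity), inv_mul_cancel₀ hm'.ne']
  simp

/-- The variance of an empirical mean of `m` samples is at most the second moment over `m`. -/
lemma lintegral_sq_empiricalMean_sub_le {T : Type*} [MeasurableSpace T] (ν : Measure T)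
    [IsProbabilityMeasure ν] {f : T → ℝ} (hf : MemLp f 2 ν) {m : ℕ} (hm : 0 < m) :
    ∫⁻ X : Fin m → T, ENNReal.ofReal (((m : ℝ)⁻¹ * ∑ s, f (X s) - ∫ t, f t ∂ν) ^ 2)
        ∂(Measure.pi fun _ : Fin m => ν) ≤
      ENNReal.ofReal (m : ℝ)⁻¹ * ∫⁻ t, ENNReal.ofReal (f t ^ 2) ∂ν := by
  have hm' : (0 : ℝ) < m := by exact_mod_cast hm
  set P := Measure.pi fun _ : Fin m => ν
  have heval (s : Fin m) : MemLp (fun X : Fin m → T => f (X s)) 2 P :=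
    hf.comp_measurePreserving (measurePreserving_eval (fun _ : Fin m => ν) s)
  have hsum : MemLp (fun X : Fin m → T => ∑ s, f (X s)) 2 P :=
    memLp_finsetSum _ fun s _ => heval s
  have hmean : ∫ X : Fin m → T, (m : ℝ)⁻¹ * ∑ s, f (X s) ∂P = ∫ t, f t ∂ν := by
    rw [integral_const_mul, integral_finsetSum _ fun s _ => (heval s).integrable (by norm_num)]
    have (s : Fin m) : ∫ X : Fin m → T, f (X s) ∂P = ∫ t, f t ∂ν :=
      integral_comp_eval (μ := fun _ : Fin m => ν) hf.aestronglyMeasurable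
    simp_rw [this]
    simp [hm'.ne']
  have hvar : ProbabilityTheory.variance (fun X : Fin m → T => ∑ s, f (X s)) P =
      m * ProbabilityTheory.variance f ν := by
    have h := ProbabilityTheory.variance_sum_pi (μ := fun _ : Fin m => ν) (X := fun _ => f)
      fun _ => hf
    rw [Finset.sum_const, Finset.card_univ, Fintype.card_fin, nsmul_eq_mul] at h
    rw [← h]
    congr 1
    ext X
    simp
  have hev := ProbabilityTheory.evariance_eq_lintegral_ofReal
    (X := fun X : Fin m → T => (m : ℝ)⁻¹ * ∑ s, f (X s)) (μ := P)
  rw [hmean] at hev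
  rw [← hev, ← ProbabilityTheory.ofReal_variance (hsum.const_mul _),
    ProbabilityTheory.variance_const_mul, hvar,
    ← ofReal_integral_eq_lintegral_ofReal hf.integrable_sq (ae_of_all _ fun _ => sq_nonneg _),
    ← ENNReal.ofReal_mul (by positivity)]
  apply ENNReal.ofReal_le_ofReal
  calc (m : ℝ)⁻¹ ^ 2 * (m * ProbabilityTheory.variance f ν)
      = (m : ℝ)⁻¹ * ProbabilityTheory.variance f ν := by field_simp
    _ ≤ _ := by
      gcongr
      exact ProbabilityTheory.variance_le_expectation_sq hf.aestronglyMeasurable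

/-- Parseval's identity in extended nonnegative form. -/
lemma HilbertBasis.tsum_ofReal_sq_inner {ι E : Type*} [NormedAddCommGroup E]
    [InnerProductSpace ℝ E] (b : HilbertBasis ι ℝ E) (x : E) :
    ∑' l, ENNReal.ofReal (⟪b l, x⟫ ^ 2) = ENNReal.ofReal (‖x‖ ^ 2) := by
  have h := b.hasSum_inner_mul_inner x x
  have h' : HasSum (fun l => ⟪b l, x⟫ ^ 2) (‖x‖ ^ 2) := by
    rw [← real_inner_self_eq_norm_sq]
    simpa only [sq, real_inner_comm x] using h
  rw [← ENNReal.ofReal_tsum_of_nonneg (fun l => sq_nonneg _) h'.summable, h'.tsum_eq]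

lemma ENNReal.ofReal_tsum_le {α : Type*} {f : α → ℝ} (hf : ∀ a, 0 ≤ f a) :
    ENNReal.ofReal (∑' a, f a) ≤ ∑' a, ENNReal.ofReal (f a) := by
  by_cases h : Summable f
  · exact (ENNReal.ofReal_tsum_of_nonneg hf h).le
  · simp [tsum_eq_zero_of_not_summable h]

/-- Chebyshev's inequality for the Hilbert–Schmidt norm of a random operator, in terms of the
second moments of its matrix coefficients. -/
lemma measure_lt_sqrt_tsum_norm_sq_le {Ω E F ι ι' : Type*} [MeasurableSpace Ω] {P : Measure Ω}
    [NormedAddCommGroup E] [InnerProductSpace ℝ E] [NormedAddCommGroup F]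
    [InnerProductSpace ℝ F] [Countable ι] [Countable ι'] (e : HilbertBasis ι ℝ E)
    (b : HilbertBasis ι' ℝ F) (A : Ω → E →L[ℝ] F)
    (hA : ∀ k l, Measurable fun ω => ⟪b l, A ω (e k)⟫) {C r : ℝ} (hC : 0 < C) (hr : 0 < r)
    (hAC : ∑' k, ∑' l, ∫⁻ ω, ENNReal.ofReal (⟪b l, A ω (e k)⟫ ^ 2) ∂P ≤
      ENNReal.ofReal (C ^ 2)) :
    P {ω | C / r < Real.sqrt (∑' k, ‖A ω (e k)‖ ^ 2)} ≤ ENNReal.ofReal (r ^ 2) := by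
  set g : Ω → ENNReal := fun ω => ∑' k, ∑' l, ENNReal.ofReal (⟪b l, A ω (e k)⟫ ^ 2) with hg
  have hterm (k : ι) (l : ι') : Measurable fun ω => ENNReal.ofReal (⟪b l, A ω (e k)⟫ ^ 2) :=
    ((hA k l).pow_const 2).ennreal_ofReal
  have hrow (k : ι) : Measurable fun ω => ∑' l, ENNReal.ofReal (⟪b l, A ω (e k)⟫ ^ 2) :=
    Measurable.tsum (hterm k)
  have hgm : Measurable g := Measurable.tsum hrow
  have hgint : ∫⁻ ω, g ω ∂P ≤ ENNReal.ofReal (C ^ 2) := by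
    rw [hg, lintegral_tsum fun k => (hrow k).aemeasurable]
    simp_rw [fun k => lintegral_tsum (μ := P) fun l => (hterm k l).aemeasurable]
    exact hAC
  have hpos : 0 < (C / r) ^ 2 := by positivity
  have hsub : {ω | C / r < Real.sqrt (∑' k, ‖A ω (e k)‖ ^ 2)} ⊆
      {ω | ENNReal.ofReal ((C / r) ^ 2) ≤ g ω} := by
    intro ω hω
    have h := (Real.lt_sqrt (by positivity)).1 (Set.mem_ofPred_eq ▸ hω)
    calc ENNReal.ofReal ((C / r) ^ 2) ≤ ENNReal.ofReal (∑' k, ‖A ω (e k)‖ ^ 2) :=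
          ENNReal.ofReal_le_ofReal h.le
      _ ≤ ∑' k, ENNReal.ofReal (‖A ω (e k)‖ ^ 2) :=
          ENNReal.ofReal_tsum_le fun _ => sq_nonneg _
      _ = g ω := by simp_rw [hg, b.tsum_ofReal_sq_inner]
  refine (measure_mono hsub).trans <| (meas_ge_le_lintegral_div hgm.aemeasurable
    (ENNReal.ofReal_pos.2 hpos).ne' ENNReal.ofReal_ne_top).trans <|
    (ENNReal.div_le_div_right hgint _).trans ?_
  rw [← ENNReal.ofReal_div_of_pos hpos]
  apply ENNReal.ofReal_le_ofReal
  apply le_of_eq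
  field_simp

/-- A feature map of a continuous kernel is continuous. -/
lemma continuous_of_continuous_inner {T E : Type*} [TopologicalSpace T] [NormedAddCommGroup E]
    [InnerProductSpace ℝ E] {φ : T → E} (h : Continuous fun p : T × T => ⟪φ p.1, φ p.2⟫) :
    Continuous φ := by
  refine continuous_iff_continuousAt.2 fun t₀ => ?_
  rw [ContinuousAt, tendsto_iff_norm_sub_tendsto_zero]
  have hc : Continuous fun t => Real.sqrt (⟪φ t, φ t⟫ - 2 * ⟪φ t, φ t₀⟫ + ⟪φ t₀, φ t₀⟫) := by
    have h₁ : Continuous fun t => ⟪φ t, φ t⟫ := h.comp (continuous_id.prodMk continuous_id)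
    have h₂ : Continuous fun t => ⟪φ t, φ t₀⟫ := h.comp (continuous_id.prodMk continuous_const)
    fun_prop
  have heq : (fun t => ‖φ t - φ t₀‖) =
      fun t => Real.sqrt (⟪φ t, φ t⟫ - 2 * ⟪φ t, φ t₀⟫ + ⟪φ t₀, φ t₀⟫) := by
    ext t
    rw [real_inner_self_eq_norm_sq, real_inner_self_eq_norm_sq, ← norm_sub_sq_real,
      Real.sqrt_sq (norm_nonneg _)]
  have := hc.tendsto t₀
  rw [← heq] at this
  convert this using 2
  rw [two_mul, sub_add_cancel_right, neg_add_cancel, Real.sqrt_zero]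

theorem empirical_cross_covariance_concentration_general
    {T : Type*} [MetricSpace T] [SigmaCompactSpace T] [MeasurableSpace T] [BorelSpace T]
    (ν : Measure T) [IsProbabilityMeasure ν]
    (K : Fin 2 → T → T → ℝ)
    (hKcont : ∀ i, Continuous fun p : T × T => K i p.1 p.2)
    (hKsymm : ∀ i s t, K i s t = K i t s)
    (hKpos : ∀ i (n : ℕ) (x : Fin n → T) (c : Fin n → ℝ),
      0 ≤ ∑ a, ∑ b, c a * c b * K i (x a) (x b))
    (κ : Fin 2 → ℝ) (hκ : ∀ i, 0 < κ i)
    (hKint : ∀ i, Integrable (fun x => K i x x ^ 2) ν)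
    (htr : ∀ i, ∫ x, K i x x ^ 2 ∂ν ≤ κ i ^ 4)
    (H : Fin 2 → Type*) [∀ i, NormedAddCommGroup (H i)] [∀ i, InnerProductSpace ℝ (H i)]
    [∀ i, CompleteSpace (H i)]
    (Φ : ∀ i, T → H i)
    (hΦ : ∀ i s t, ⟪Φ i s, Φ i t⟫ = K i s t)
    (hdense : ∀ i, (Submodule.span ℝ (Set.range (Φ i))).topologicalClosure = ⊤)
    (ι : Fin 2 → Type*) [∀ i, Countable (ι i)]
    (e : ∀ i, HilbertBasis (ι i) ℝ (H i))
    (R : ∀ i j, H j →L[ℝ] H i)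
    (hR : ∀ i j (f : H j), R i j f = ∫ t, ⟪Φ j t, f⟫ • Φ i t ∂ν)
    (m : ℕ) (hm : 0 < m)
    (RX : ∀ i j, (Fin m → T) → (H j →L[ℝ] H i))
    (hRX : ∀ i j (X : Fin m → T) (f : H j),
      RX i j X f = (m : ℝ)⁻¹ • ∑ k, ⟪Φ j (X k), f⟫ • Φ i (X k)) :
    ∀ i j (δ : ℝ), 0 < δ → δ < 1 →
      ENNReal.ofReal (1 - δ) ≤
        (Measure.pi fun _ : Fin m => ν) {X : Fin m → T |
          Real.sqrt (∑' k, ‖RX i j X (e j k)‖ ^ 2) ≤ 2 * κ i * κ j / δ ∧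
          Real.sqrt (∑' k, ‖(RX i j X - R i j) (e j k)‖ ^ 2) ≤
            2 * κ i * κ j / (Real.sqrt m * δ) } := by
  intro i j δ hδ hδ1
  have hΦc (i) : Continuous (Φ i) :=
    continuous_of_continuous_inner (by simpa only [hΦ] using hKcont i)
  have hnorm (i t) : ‖Φ i t‖ ^ 2 = K i t t := by rw [← real_inner_self_eq_norm_sq, hΦ]
  have hKnn (i t) : 0 ≤ K i t t := hnorm i t ▸ sq_nonneg _
  have hdiag (i) : Continuous fun t => K i t t :=
    (hKcont i).comp (continuous_id.prodMk continuous_id)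
  have hκi := hκ i
  have hκj := hκ j
  have hm' : (0 : ℝ) < m := by exact_mod_cast hm
  have hprod_le (t : T) : K j t t * K i t t ≤
      (κ i ^ 2 / κ j ^ 2 * K j t t ^ 2 + κ j ^ 2 / κ i ^ 2 * K i t t ^ 2) / 2 := by
    have h := sq_nonneg (κ i / κ j * K j t t - κ j / κ i * K i t t)
    have h' : (κ i / κ j * K j t t - κ j / κ i * K i t t) ^ 2 =
      κ i ^ 2 / κ j ^ 2 * K j t t ^ 2 + κ j ^ 2 / κ i ^ 2 * K i t t ^ 2 -
        2 * (K j t t * K i t t) := by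
      field_simp
      ring
    linarith
  have hbound_int : Integrable (fun t =>
      (κ i ^ 2 / κ j ^ 2 * K j t t ^ 2 + κ j ^ 2 / κ i ^ 2 * K i t t ^ 2) / 2) ν :=
    (((hKint j).const_mul _).add ((hKint i).const_mul _)).div_const _
  have hprod_int : Integrable (fun t => K j t t * K i t t) ν :=
    hbound_int.mono' ((hdiag j).mul (hdiag i)).aestronglyMeasurable (ae_of_all _ fun t => by
      rw [Real.norm_of_nonneg (mul_nonneg (hKnn j t) (hKnn i t))]
      exact hprod_le t)
  have hprod : ∫ t, K j t t * K i t t ∂ν ≤ (κ i * κ j) ^ 2 := by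
    refine (integral_mono hprod_int hbound_int hprod_le).trans ?_
    rw [integral_div, integral_add ((hKint j).const_mul _) ((hKint i).const_mul _),
      integral_const_mul, integral_const_mul]
    calc _ ≤ (κ i ^ 2 / κ j ^ 2 * κ j ^ 4 + κ j ^ 2 / κ i ^ 2 * κ i ^ 4) / 2 := by
          gcongr
          · exact htr j
          · exact htr i
      _ = _ := by field_simp; ring
  set f : ι j → ι i → T → ℝ := fun k l t => ⟪Φ j t, e j k⟫ * ⟪e i l, Φ i t⟫ with hf
  have hfc (k l) : Continuous (f k l) := by
    have h₁ := hΦc i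
    have h₂ := hΦc j
    fun_prop
  have hf_sq_le (k l t) : f k l t ^ 2 ≤ K j t t * K i t t := by
    have h {n : Fin 2} (a b : H n) : ⟪a, b⟫ ^ 2 ≤ ‖a‖ ^ 2 * ‖b‖ ^ 2 := by
      rw [← mul_pow, sq_le_sq, abs_of_nonneg (by positivity : 0 ≤ ‖a‖ * ‖b‖)]
      exact abs_real_inner_le_norm a b
    have h₁ := h (Φ j t) (e j k)
    have h₂ := h (e i l) (Φ i t)
    rw [(e j).orthonormal.1 k, hnorm] at h₁
    rw [(e i).orthonormal.1 l, hnorm] at h₂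
    rw [hf, mul_pow]
    refine mul_le_mul ?_ ?_ (sq_nonneg _) (hKnn j t) <;> linarith
  have hfL (k l) : MemLp (f k l) 2 ν := by
    rw [memLp_two_iff_integrable_sq (hfc k l).aestronglyMeasurable]
    exact hprod_int.mono' ((hfc k l).pow 2).aestronglyMeasurable (ae_of_all _ fun t => by
      rw [Real.norm_of_nonneg (sq_nonneg _)]
      exact hf_sq_le k l t)
  have hf_meas (k l) : Measurable fun t => ENNReal.ofReal (f k l t ^ 2) :=
    ((hfc k l).measurable.pow_const 2).ennreal_ofReal
  have hf_sum : ∑' k, ∑' l, ∫⁻ t, ENNReal.ofReal (f k l t ^ 2) ∂ν ≤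
      ENNReal.ofReal ((κ i * κ j) ^ 2) := by
    simp_rw [fun k => (lintegral_tsum (μ := ν) fun l => (hf_meas k l).aemeasurable).symm]
    rw [← lintegral_tsum fun k => (Measurable.tsum (hf_meas k)).aemeasurable]
    refine le_trans (le_of_eq ?_) (ENNReal.ofReal_le_ofReal hprod)
    rw [ofReal_integral_eq_lintegral_ofReal hprod_int
      (ae_of_all _ fun t => mul_nonneg (hKnn j t) (hKnn i t))]
    congr with t
    simp_rw [hf, mul_pow, ENNReal.ofReal_mul (sq_nonneg _), ENNReal.tsum_mul_left,
      (e i).tsum_ofReal_sq_inner, ENNReal.tsum_mul_right, real_inner_comm (e j _),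
      (e j).tsum_ofReal_sq_inner, hnorm, ENNReal.ofReal_mul (hKnn j t)]
  have hRXc (X : Fin m → T) (k l) :
      ⟪e i l, RX i j X (e j k)⟫ = (m : ℝ)⁻¹ * ∑ s, f k l (X s) := by
    simp only [hRX, hf, real_inner_smul_right, inner_sum]
  have hRc (k l) : ⟪e i l, R i j (e j k)⟫ = ∫ t, f k l t ∂ν := by
    have hint : Integrable (fun t => ⟪Φ j t, e j k⟫ • Φ i t) ν := by
      have hc : Continuous fun t => ⟪Φ j t, e j k⟫ • Φ i t := by
        have h₁ := hΦc i
        have h₂ := hΦc j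
        fun_prop
      refine (hprod_int.add (integrable_const 1)).mono' hc.aestronglyMeasurable
        (ae_of_all _ fun t => ?_)
      have h₁ := norm_inner_le_norm (𝕜 := ℝ) (Φ j t) (e j k)
      rw [(e j).orthonormal.1 k, mul_one] at h₁
      rw [norm_smul, Pi.add_apply, ← hnorm, ← hnorm]
      calc _ ≤ ‖Φ j t‖ * ‖Φ i t‖ := by gcongr
        _ ≤ _ := by nlinarith [sq_nonneg (‖Φ j t‖ * ‖Φ i t‖ - 1)]
    rw [hR, ← integral_inner hint]
    simp only [hf, real_inner_smul_right]
  set P := Measure.pi fun _ : Fin m => ν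
  have hRX_meas (k l) : Measurable fun X => ⟪e i l, RX i j X (e j k)⟫ := by
    simp_rw [hRXc]
    have := (hfc k l).measurable
    fun_prop
  have hbad₁ : P {X | κ i * κ j / (δ / 2) < Real.sqrt (∑' k, ‖RX i j X (e j k)‖ ^ 2)} ≤
      ENNReal.ofReal ((δ / 2) ^ 2) := by
    refine measure_lt_sqrt_tsum_norm_sq_le (e j) (e i) (RX i j) hRX_meas (by positivity)
      (by positivity) (le_trans ?_ hf_sum)
    simp_rw [hRXc]
    gcongr with k l
    exact lintegral_sq_empiricalMean_le ν (hfc k l).measurable hm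
  have hbad₂ : P {X | κ i * κ j / Real.sqrt m / (δ / 2) <
      Real.sqrt (∑' k, ‖(RX i j X - R i j) (e j k)‖ ^ 2)} ≤ ENNReal.ofReal ((δ / 2) ^ 2) := by
    refine measure_lt_sqrt_tsum_norm_sq_le (e j) (e i) (fun X => RX i j X - R i j) ?_
      (by positivity) (by positivity) ?_
    · intro k l
      simp only [sub_apply, inner_sub_right]
      exact (hRX_meas k l).sub_const _
    · simp only [sub_apply, inner_sub_right, hRXc, hRc]
      calc _ ≤ ∑' k, ∑' l, ENNReal.ofReal (m : ℝ)⁻¹ * ∫⁻ t, ENNReal.ofReal (f k l t ^ 2) ∂ν := by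
            gcongr with k l
            exact lintegral_sq_empiricalMean_sub_le ν (hfL k l) hm
        _ ≤ ENNReal.ofReal (m : ℝ)⁻¹ * ENNReal.ofReal ((κ i * κ j) ^ 2) := by
            simp_rw [ENNReal.tsum_mul_left]
            gcongr
        _ = _ := by
            rw [← ENNReal.ofReal_mul (by positivity), div_pow, Real.sq_sqrt hm'.le]
            congr 1
            ring
  set S := {X : Fin m → T |
    Real.sqrt (∑' k, ‖RX i j X (e j k)‖ ^ 2) ≤ 2 * κ i * κ j / δ ∧
    Real.sqrt (∑' k, ‖(RX i j X - R i j) (e j k)‖ ^ 2) ≤ 2 * κ i * κ j / (Real.sqrt m * δ)} with hS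
  set B₁ := {X | κ i * κ j / (δ / 2) < Real.sqrt (∑' k, ‖RX i j X (e j k)‖ ^ 2)} with hB₁
  set B₂ := {X | κ i * κ j / Real.sqrt m / (δ / 2) <
      Real.sqrt (∑' k, ‖(RX i j X - R i j) (e j k)‖ ^ 2)} with hB₂
  have hcover : Set.univ ⊆ S ∪ (B₁ ∪ B₂) := by
    intro X _
    have h₁ : κ i * κ j / (δ / 2) = 2 * κ i * κ j / δ := by field_simp
    have h₂ : κ i * κ j / Real.sqrt m / (δ / 2) = 2 * κ i * κ j / (Real.sqrt m * δ) := by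
      field_simp
    simp only [hS, hB₁, hB₂, Set.mem_union, Set.mem_ofPred_eq, h₁, h₂]
    grind
  have htot : 1 ≤ P S + ENNReal.ofReal δ := by
    calc (1 : ENNReal) = P Set.univ := measure_univ.symm
      _ ≤ P S + (P B₁ + P B₂) :=
        (measure_mono hcover).trans ((measure_union_le _ _).trans
          (by gcongr; exact measure_union_le _ _))
      _ ≤ P S + (ENNReal.ofReal ((δ / 2) ^ 2) + ENNReal.ofReal ((δ / 2) ^ 2)) := by gcongr
      _ ≤ P S + ENNReal.ofReal δ := by
        rw [← ENNReal.ofReal_add (by positivity) (by positivity)]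
        gcongr
        nlinarith
  rw [ENNReal.ofReal_sub _ hδ.le, ENNReal.ofReal_one]
  exact tsub_le_iff_right.2 htot

end
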